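/- There exists an absolute constant c > 0 such that for every f ∈ (0,1/2) there is an N with the following property: for all integers n ≥ N and all integers M with M ≥ (c/(1−2f))·√(log log n)·2^n / (Σ_{i=0}^{⌊fn⌋} C(n,i)), Paul wins the ((M,0,…,0), n, ⌊fn⌋)*₂ pathological liar game. Here log denotes the natural logarithm and C(n,i) the binomial coefficient. -/

import Mathlib

/-- Right shift of a state vector: `R(y) = (0, y(0), …, y(e-1))`. -/
def shiftR {e : ℕ} (y : Fin (e + 1) → ℕ) : Fin (e + 1) → ℕ :=
  fun i => if (i : ℕ) = 0 then 0 else y ⟨(i : ℕ) - 1, by have := i.isLt; omega⟩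

/-- The state after Carole answers "Yes": `Y(x,a) = a + R(x - a)`. -/
def yesState {e : ℕ} (x a : Fin (e + 1) → ℕ) : Fin (e + 1) → ℕ :=
  fun i => a i + shiftR (fun k => x k - a k) i

/-- The state after Carole answers "No": `N(x,a) = (x - a) + R(a)`. -/
def noState {e : ℕ} (x a : Fin (e + 1) → ℕ) : Fin (e + 1) → ℕ :=
  fun i => (x i - a i) + shiftR a i

/-- Paul wins the `(x, n, e)*₂` pathological liar game. -/
def PaulWins {e : ℕ} : ℕ → (Fin (e + 1) → ℕ) → Prop
  | 0, x => 1 ≤ ∑ i, x i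
  | n + 1, x => ∃ a : Fin (e + 1) → ℕ, (∀ i, a i ≤ x i) ∧
      PaulWins n (yesState x a) ∧ PaulWins n (noState x a)

/-- extension of a state by zero -/
def extS {e : ℕ} (x : Fin (e + 1) → ℕ) (i : ℕ) : ℕ := if h : i < e + 1 then x ⟨i, h⟩ else 0

/-- number of chips at positions below `j` -/
def preS {e : ℕ} (x : Fin (e + 1) → ℕ) (j : ℕ) : ℕ := ∑ i ∈ Finset.range j, extS x i

theorem preS_full {e : ℕ} (x : Fin (e + 1) → ℕ) : preS x (e + 1) = ∑ i, x i := by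
  unfold preS
  rw [Finset.sum_range]
  refine Finset.sum_congr rfl fun i _ => ?_
  simp only [extS, i.isLt, dif_pos]

theorem ext_shift_zero {e : ℕ} (y : Fin (e + 1) → ℕ) : extS (shiftR y) 0 = 0 := by
  simp [extS, shiftR]

theorem ext_shift_succ {e : ℕ} (y : Fin (e + 1) → ℕ) (i : ℕ) (h : i + 1 < e + 1) :
    extS (shiftR y) (i + 1) = extS y i := by
  have h' : i < e + 1 := by omega
  simp only [extS, shiftR, h, h', dif_pos]
  simp

theorem ext_add {e : ℕ} (y z : Fin (e + 1) → ℕ) (i : ℕ) :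
    extS (fun k => y k + z k) i = extS y i + extS z i := by
  unfold extS; split_ifs <;> simp

theorem pre_step {e : ℕ} (x a b : Fin (e + 1) → ℕ) (hab : ∀ i, a i + b i = x i) (j : ℕ)
    (hj : j < e + 1) :
    preS (fun i => a i + shiftR b i) (j + 1) = preS x j + extS a j := by
  induction j with
  | zero => simp [preS, ext_add, ext_shift_zero]
  | succ j ih =>
    have h1 := ih (by omega)
    have hx : extS x j = extS a j + extS b j := by
      rw [← ext_add]; congr 1; funext i; exact (hab i).symm
    unfold preS at h1 ⊢
    rw [Finset.sum_range_succ, h1, Finset.sum_range_succ, ext_add, ext_shift_succ _ _ hj, hx]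
    omega

theorem potential {e : ℕ} (p : ℕ → ℕ → ℝ) (hp : ∀ k i, 0 ≤ p k i)
    (h00 : p 0 0 ≤ 1) (h0 : ∀ i, p 0 (i + 1) = 0)
    (hr0 : ∀ k, 2 * p (k + 1) 0 ≤ p k 0)
    (hr : ∀ k i, 2 * p (k + 1) (i + 1) ≤ p k (i + 1) + p k i) (k : ℕ) :
    ∀ x : Fin (e + 1) → ℕ,
      (1 / 2) * ∑ l ∈ Finset.range k, ∑ i ∈ Finset.range (e + 1), p l i <
        ∑ i ∈ Finset.range (e + 1), p k i * preS x (e + 1 - i) → PaulWins k x := by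
  induction k with
  | zero =>
    intro x hx
    simp only [PaulWins]
    rw [← preS_full]
    rw [Finset.sum_range_succ'] at hx
    simp only [h0, Finset.range_zero, Finset.sum_empty, zero_mul, Finset.sum_const_zero] at hx
    by_contra hc
    have : preS x (e + 1) = 0 := by omega
    simp [this] at hx
  | succ k ih =>
    intro x hx
    have key : ∀ z : Fin (e + 1) → ℕ,
        (∀ j < e + 1, preS x (j + 1) + preS x j ≤ 2 * preS z (j + 1) + 1) → PaulWins k z := by
      intro z hz
      apply ih
      rw [Finset.sum_range_succ] at hx
      have h1 : ∑ i ∈ Finset.range (e + 1), p (k + 1) i * preS x (e + 1 - i) ≤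
          ∑ i ∈ Finset.range (e + 1), p k i * (((preS x (e + 1 - i) : ℝ) + preS x (e - i)) / 2) := by
        have h2 : ∑ i ∈ Finset.range (e + 1), p k i * (((preS x (e + 1 - i) : ℝ) + preS x (e - i)) / 2)
            = (∑ i ∈ Finset.range (e + 1), p k i * (preS x (e + 1 - i) : ℝ)) / 2 +
              (∑ i ∈ Finset.range (e + 1), p k i * (preS x (e - i) : ℝ)) / 2 := by
          rw [Finset.sum_div, Finset.sum_div, ← Finset.sum_add_distrib]
          refine Finset.sum_congr rfl fun i _ => by ring
        rw [h2, Finset.sum_range_succ' (fun i => p (k + 1) i * (preS x (e + 1 - i) : ℝ)),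
          Finset.sum_range_succ' (fun i => p k i * (preS x (e + 1 - i) : ℝ)),
          Finset.sum_range_succ (fun i => p k i * (preS x (e - i) : ℝ))]
        have h3 : (preS x (e - e) : ℝ) = 0 := by simp [preS]
        rw [h3]
        have h4 : ∑ i ∈ Finset.range e, p (k + 1) (i + 1) * (preS x (e + 1 - (i + 1)) : ℝ) ≤
            (∑ i ∈ Finset.range e, p k (i + 1) * (preS x (e + 1 - (i + 1)) : ℝ)) / 2 +
            (∑ i ∈ Finset.range e, p k i * (preS x (e - i) : ℝ)) / 2 := by
          rw [Finset.sum_div, Finset.sum_div, ← Finset.sum_add_distrib]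
          refine Finset.sum_le_sum fun i _ => ?_
          have : e + 1 - (i + 1) = e - i := by omega
          rw [this]
          have h5 : (0 : ℝ) ≤ preS x (e - i) := Nat.cast_nonneg _
          nlinarith [mul_le_mul_of_nonneg_right (hr k i) h5]
        have h6 : (0 : ℝ) ≤ preS x (e + 1 - 0) := Nat.cast_nonneg _
        nlinarith [mul_le_mul_of_nonneg_right (hr0 k) h6]
      have h7 : ∑ i ∈ Finset.range (e + 1), p k i * (((preS x (e + 1 - i) : ℝ) + preS x (e - i)) / 2) ≤
          ∑ i ∈ Finset.range (e + 1), p k i * (preS z (e + 1 - i) : ℝ) +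
            1 / 2 * ∑ i ∈ Finset.range (e + 1), p k i := by
        rw [Finset.mul_sum, ← Finset.sum_add_distrib]
        refine Finset.sum_le_sum fun i hi => ?_
        have hi' := Finset.mem_range.1 hi
        have h8 := hz (e - i) (by omega)
        have h9 : e + 1 - i = e - i + 1 := by omega
        rw [h9]
        have h10 : (preS x (e - i + 1) : ℝ) + preS x (e - i) ≤ 2 * preS z (e - i + 1) + 1 := by
          exact_mod_cast h8
        nlinarith [mul_le_mul_of_nonneg_left h10 (hp k i)]
      linarith
    have hdiv : ∀ i, x i / 2 ≤ x i := fun i => Nat.div_le_self _ _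
    refine ⟨fun i => x i / 2, hdiv, key _ ?_, key _ ?_⟩
    · intro j hj
      have := pre_step x (fun i => x i / 2) (fun i => x i - x i / 2)
        (fun i => by have := hdiv i; omega) j hj
      have h2 : preS (yesState x fun i => x i / 2) (j + 1) = _ := this
      rw [h2]
      have : preS x (j + 1) = preS x j + extS x j := by simp [preS, Finset.sum_range_succ]
      have : extS x j ≤ 2 * extS (fun i => x i / 2) j + 1 := by
        simp only [extS, hj, dif_pos]; omega
      omega
    · intro j hj
      have := pre_step x (fun i => x i - x i / 2) (fun i => x i / 2)
        (fun i => by have := hdiv i; omega) j hj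
      have h2 : preS (noState x fun i => x i / 2) (j + 1) = _ := this
      rw [h2]
      have : preS x (j + 1) = preS x j + extS x j := by simp [preS, Finset.sum_range_succ]
      have : extS x j ≤ 2 * extS (fun i => x i - x i / 2) j + 1 := by
        simp only [extS, hj, dif_pos]; omega
      omega

/-- ballot-type weights -/
noncomputable def qW (β : ℝ) : ℕ → ℕ → ℝ
  | 0, 0 => 1
  | 0, _ + 1 => 0
  | _ + 1, 0 => 1
  | k + 1, i + 1 => max 0 (((k + 1).choose (i + 1) : ℝ) - β * (k.choose i : ℝ))

theorem qW_nonneg (β : ℝ) (k i : ℕ) : 0 ≤ qW β k i := by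
  rcases k with _ | k <;> rcases i with _ | i <;> simp [qW]

theorem qW_zero (β : ℝ) (k : ℕ) : qW β k 0 = 1 := by
  rcases k with _ | k <;> simp [qW]

theorem qW_rec (β : ℝ) (hβ : 1 ≤ β) (k i : ℕ) :
    qW β (k + 1) (i + 1) ≤ qW β k (i + 1) + qW β k i := by
  have h1 := qW_nonneg β k (i + 1)
  have h2 := qW_nonneg β k i
  refine max_le (by linarith) ?_
  rcases k with _ | k
  · rcases i with _ | i
    · simp [qW]; linarith
    · simp [qW, Nat.choose_eq_zero_of_lt]
  · have h3 : ((k + 1).choose (i + 1) : ℝ) - β * (k.choose i : ℝ) ≤ qW β (k + 1) (i + 1) :=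
      le_max_right _ _
    rcases i with _ | i
    · rw [qW_zero]
      have : ((k + 1 + 1).choose (0 + 1) : ℝ) = (k + 1).choose (0 + 1) + 1 := by simp
      rw [this]
      simp at h3 ⊢
      linarith
    · have h4 : ((k + 1).choose (i + 1) : ℝ) - β * (k.choose i : ℝ) ≤ qW β (k + 1) (i + 1) :=
        le_max_right _ _
      rw [Nat.choose_succ_succ (k + 1) (i + 1), Nat.choose_succ_succ k i] 
      rw [Nat.choose_succ_succ k i] at h4
      push_cast at *
      linarith

theorem qW_eq (β : ℝ) (k i : ℕ) :
    (((k + 1).choose (i + 1) : ℝ) - β * (k.choose i : ℝ)) * (k + 1) =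
      ((k + 1).choose (i + 1) : ℝ) * ((k + 1) - β * (i + 1)) := by
  have h := Nat.add_one_mul_choose_eq k i
  have h' : ((k : ℝ) + 1) * (k.choose i : ℝ) = ((k + 1).choose (i + 1) : ℝ) * (i + 1) := by
    exact_mod_cast h
  linear_combination (-β) * h'

theorem qW_upper (β s : ℝ) (hs : 0 ≤ s) (hβ : 0 ≤ β) (k i : ℕ) :
    qW β k i ≤ (k.choose i : ℝ) * Real.exp (s * (k - β * i)) := by
  rcases i with _ | i
  · rw [qW_zero]
    simp
    positivity
  rcases k with _ | k
  · simp [qW]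
  have hk : (0 : ℝ) < k + 1 := by positivity
  have e1 := qW_eq β k i
  refine max_le (by positivity) ?_
  push_cast
  rcases le_total (β * (i + 1)) ((k : ℝ) + 1) with h | h
  · have h1 : 1 ≤ Real.exp (s * ((k : ℝ) + 1 - β * (i + 1))) :=
      Real.one_le_exp (mul_nonneg hs (by linarith))
    have h2 : (0 : ℝ) ≤ ((k + 1).choose (i + 1) : ℝ) := Nat.cast_nonneg _
    have h3 : 0 ≤ β * (k.choose i : ℝ) := by positivity
    nlinarith
  · have h2 : (((k + 1).choose (i + 1) : ℝ) - β * (k.choose i : ℝ)) ≤ 0 := by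
      by_contra hc
      push Not at hc
      have := mul_pos hc hk
      rw [e1] at this
      have h4 : ((k + 1).choose (i + 1) : ℝ) * ((k + 1) - β * (i + 1)) ≤ 0 :=
        mul_nonpos_of_nonneg_of_nonpos (Nat.cast_nonneg _) (by linarith)
      linarith
    exact h2.trans (by positivity)

theorem qW_lower (β : ℝ) (f : ℝ) (hβ : 0 ≤ β) (n i : ℕ) (hi : (i : ℝ) ≤ f * n) (hf : 0 ≤ f) :
    (1 - β * f) * (n.choose i : ℝ) ≤ qW β n i := by
  rcases i with _ | i
  · rw [qW_zero]; simp; positivity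
  rcases n with _ | k
  · simp [qW]
  have hk : (0 : ℝ) < k + 1 := by positivity
  have e1 := qW_eq β k i
  refine le_trans ?_ (le_max_right _ _)
  refine le_of_mul_le_mul_right ?_ hk
  rw [e1]
  push_cast at hi
  have h2 : (0 : ℝ) ≤ ((k + 1).choose (i + 1) : ℝ) := Nat.cast_nonneg _
  have h3 : (1 - β * f) * (k + 1) ≤ (k + 1) - β * (i + 1) := by
    nlinarith [mul_le_mul_of_nonneg_left hi hβ]
  calc _ = ((k + 1).choose (i + 1) : ℝ) * ((1 - β * f) * (k + 1)) := by ring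
    _ ≤ _ := mul_le_mul_of_nonneg_left h3 h2

theorem exists_rate (β : ℝ) (hβ : 2 < β) :
    ∃ s : ℝ, 0 ≤ s ∧ Real.exp s * (1 + Real.exp (-(s * β))) / 2 < 1 := by
  have hD : 0 < 2 * (1 + (β - 1) ^ 2) := by positivity
  set s := (β - 2) / (2 * (1 + (β - 1) ^ 2)) with hs
  have hs0 : 0 < s := div_pos (by linarith) hD
  have hsD : s * (2 * (1 + (β - 1) ^ 2)) = β - 2 := by rw [hs]; field_simp
  refine ⟨s, hs0.le, ?_⟩
  have h1 : s * (β - 1) ≤ 1 := by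
    rw [hs, div_mul_eq_mul_div, div_le_one hD]; nlinarith
  have h2 : s ≤ 1 := by nlinarith
  have a1 := Real.abs_exp_sub_one_sub_id_le (x := s) (by rw [abs_of_pos hs0]; exact h2)
  have a2 := Real.abs_exp_sub_one_sub_id_le (x := -(s * (β - 1)))
    (by rw [abs_neg, abs_of_nonneg (by nlinarith)]; exact h1)
  have b1 := (abs_le.1 a1).2
  have b2 := (abs_le.1 a2).2
  have : Real.exp s * (1 + Real.exp (-(s * β))) = Real.exp s + Real.exp (-(s * (β - 1))) := by
    rw [mul_add, ← Real.exp_add]; ring_nf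
  rw [this]
  nlinarith

theorem qW_sum (β s : ℝ) (hs : 0 ≤ s) (hβ : 0 ≤ β) (k m : ℕ) :
    ∑ i ∈ Finset.range m, qW β k i / 2 ^ k ≤
      (Real.exp s * (1 + Real.exp (-(s * β))) / 2) ^ k := by
  have h1 : ∀ i, qW β k i / 2 ^ k ≤
      (k.choose i : ℝ) * Real.exp (s * (k - β * i)) / 2 ^ k := fun i => by
    have := qW_upper β s hs hβ k i
    gcongr
  have h2 : (Real.exp s * (1 + Real.exp (-(s * β))) / 2) ^ k =
      ∑ i ∈ Finset.range (k + 1), (k.choose i : ℝ) * Real.exp (s * (k - β * i)) / 2 ^ k := by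
    rw [div_pow, mul_pow, add_comm (1 : ℝ), add_pow, Finset.mul_sum, Finset.sum_div]
    refine Finset.sum_congr rfl fun i _ => ?_
    rw [← Real.exp_nat_mul, ← Real.exp_nat_mul, one_pow, mul_one, ← mul_assoc, ← Real.exp_add]
    rw [mul_comm (k.choose i : ℝ)]
    congr 3
    ring
  rw [h2]
  calc _ ≤ ∑ i ∈ Finset.range m, (k.choose i : ℝ) * Real.exp (s * (k - β * i)) / 2 ^ k :=
        Finset.sum_le_sum fun i _ => h1 i
    _ ≤ ∑ i ∈ Finset.range (m + (k + 1)), (k.choose i : ℝ) * Real.exp (s * (k - β * i)) / 2 ^ k :=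
        Finset.sum_le_sum_of_subset_of_nonneg (Finset.range_mono (by omega))
          fun i _ _ => by positivity
    _ = _ := by
        symm
        refine Finset.sum_subset (Finset.range_mono (by omega)) fun i _ hi => ?_
        rw [Nat.choose_eq_zero_of_lt (by simpa using hi)]
        simp

theorem pathological_liar_game_bound :
    ∃ c : ℝ, 0 < c ∧ ∀ f : ℝ, 0 < f → f < 1 / 2 → ∃ N : ℕ, ∀ n : ℕ, N ≤ n →
      ∀ M : ℕ,
        (c / (1 - 2 * f)) * Real.sqrt (Real.log (Real.log n)) * 2 ^ n /
            (∑ i ∈ Finset.range (⌊f * n⌋₊ + 1), (n.choose i : ℝ)) ≤ (M : ℝ) →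
        PaulWins n (fun i : Fin (⌊f * n⌋₊ + 1) => if i = 0 then M else 0) := by
  refine ⟨1, one_pos, fun f hf0 hf => ?_⟩
  set β : ℝ := 1 + 1 / (2 * f) with hβd
  have hβ : 2 < β := by
    have : 1 < 1 / (2 * f) := by rw [lt_div_iff₀ (by positivity)]; linarith
    linarith
  have hβf : 1 - β * f = (1 - 2 * f) / 2 := by rw [hβd]; field_simp; ring
  obtain ⟨s, hs, hr⟩ := exists_rate β hβ
  set r := Real.exp s * (1 + Real.exp (-(s * β))) / 2 with hrd
  have hr0 : 0 ≤ r := by positivity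
  have ht : Filter.Tendsto (fun n : ℕ => Real.sqrt (Real.log (Real.log n))) Filter.atTop
      Filter.atTop :=
    Real.tendsto_sqrt_atTop.comp (Real.tendsto_log_atTop.comp
      (Real.tendsto_log_atTop.comp tendsto_natCast_atTop_atTop))
  obtain ⟨N, hN⟩ := Filter.eventually_atTop.1 (ht.eventually_gt_atTop ((1 - r)⁻¹))
  refine ⟨N, fun n hn M hM => ?_⟩
  have hL := hN n hn
  set e := ⌊f * n⌋₊ with he
  apply potential (fun k i => qW β k i / 2 ^ k)
  · intro k i
    have := qW_nonneg β k i
    positivity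
  · simp [qW]
  · simp [qW]
  · intro k
    simp only [qW_zero]
    rw [pow_succ]
    apply le_of_eq
    field_simp
  · intro k i
    have := qW_rec β (by linarith) k i
    rw [← add_div, pow_succ]
    calc _ = qW β (k + 1) (i + 1) / 2 ^ k := by field_simp
      _ ≤ _ := by gcongr
  · have hpre : ∀ i ∈ Finset.range (e + 1),
        qW β n i / 2 ^ n * (preS (fun i : Fin (e + 1) => if i = 0 then M else 0) (e + 1 - i) : ℝ)
          = qW β n i / 2 ^ n * M := by
      intro i hi
      have hi' := Finset.mem_range.1 hi
      congr 2
      obtain ⟨j, hj⟩ : ∃ j, e + 1 - i = j + 1 := ⟨e - i, by omega⟩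
      rw [hj, preS, Finset.sum_range_succ', Finset.sum_eq_zero]
      · simp [extS]
      · intro l _
        simp only [extS, Fin.ext_iff]
        split_ifs <;> simp_all
    rw [Finset.sum_congr rfl hpre, ← Finset.sum_mul]
    have hS : 0 < ∑ i ∈ Finset.range (e + 1), (n.choose i : ℝ) := by
      rw [Finset.sum_range_succ']
      have : 0 ≤ ∑ i ∈ Finset.range e, (n.choose (i + 1) : ℝ) := by positivity
      simp
      linarith
    have hlow : (1 - 2 * f) / 2 * (∑ i ∈ Finset.range (e + 1), (n.choose i : ℝ)) / 2 ^ n ≤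
        ∑ i ∈ Finset.range (e + 1), qW β n i / 2 ^ n := by
      rw [Finset.mul_sum, Finset.sum_div]
      refine Finset.sum_le_sum fun i hi => ?_
      have hi' := Finset.mem_range.1 hi
      have h1 : (i : ℝ) ≤ f * n := by
        have h2 : (i : ℝ) ≤ e := by exact_mod_cast Nat.lt_succ_iff.1 hi'
        exact h2.trans (Nat.floor_le (by positivity))
      have := qW_lower β f (by linarith) n i h1 hf0.le
      rw [hβf] at this
      gcongr
    have hup : ∑ l ∈ Finset.range n, ∑ i ∈ Finset.range (e + 1), qW β l i / 2 ^ l ≤ (1 - r)⁻¹ := by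
      calc _ ≤ ∑ l ∈ Finset.range n, r ^ l :=
            Finset.sum_le_sum fun l _ => qW_sum β s hs (by linarith) l _
        _ ≤ ∑' l, r ^ l := (summable_geometric_of_lt_one hr0 hr).sum_le_tsum _
            (fun l _ => by positivity)
        _ = _ := tsum_geometric_of_lt_one hr0 hr
    have hfpos : 0 < 1 - 2 * f := by linarith
    have hM2 : Real.sqrt (Real.log (Real.log n)) / 2 ≤
        (1 - 2 * f) / 2 * (∑ i ∈ Finset.range (e + 1), (n.choose i : ℝ)) / 2 ^ n * M := by
      refine le_trans (le_of_eq ?_) (mul_le_mul_of_nonneg_left hM (by positivity))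
      have := hS.ne'
      have := hfpos.ne'
      field_simp
    have := mul_le_mul_of_nonneg_right hlow (Nat.cast_nonneg (α := ℝ) M)
    linarith
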